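/- Suppose the action of G_A on Y is regular and ω ∈ Ω̂ is an r-factorable sequence. Then the period growth function of the spinal group G_ω satisfies π_ω(n) ≾ n^{r·log_{4/3}(q)}. -/

import Mathlib

noncomputable section

open Equiv

namespace Spinal

/-- The letter `q` of the alphabet `{1,…,q}` (here `q = m + 2`). -/
def qtop (m : ℕ) : Fin (m + 2) := Fin.last (m + 1)

/-- The letter `1` of the alphabet. -/
def qone (m : ℕ) : Fin (m + 2) := 0


theorem qone_ne_qtop (m : ℕ) : qone m ≠ qtop m := by
  simp [qone, qtop, Fin.ext_iff]

/-- The action of an alphabet permutation on the first letter of a word. -/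
def rootFun (m : ℕ) (a : Equiv.Perm (Fin (m + 2))) :
    List (Fin (m + 2)) → List (Fin (m + 2))
  | [] => []
  | y :: w => a y :: w

theorem rootFun_leftInv (m : ℕ) (a : Equiv.Perm (Fin (m + 2))) (w : List (Fin (m + 2))) :
    rootFun m a.symm (rootFun m a w) = w := by
  cases w <;> simp [rootFun]

/-- The tree automorphism induced by a root permutation. -/
def rootAut (m : ℕ) (a : Equiv.Perm (Fin (m + 2))) : Equiv.Perm (List (Fin (m + 2))) where
  toFun := rootFun m a
  invFun := rootFun m a.symm
  left_inv w := rootFun_leftInv m a w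
  right_inv w := by simpa using rootFun_leftInv m a.symm w

variable {GB : Type*} [Group GB]

/-- The spinal action of `b : G_B` determined by the sequence `ω` of homomorphisms:
at the vertex `q^n 1` the next letter is moved by `ω n b` (0-indexed, so `ω 0` is the
paper's `ω₁`). -/
def spinalFun (m : ℕ) (ω : ℕ → GB →* Equiv.Perm (Fin (m + 2))) (b : GB) :
    ℕ → List (Fin (m + 2)) → List (Fin (m + 2))
  | _, [] => []
  | n, y :: w =>
    if y = qtop m then y :: spinalFun m ω b (n + 1) w
    else if y = qone m then
      y :: (match w with
            | [] => []
            | z :: w' => ω n b z :: w')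
    else y :: w

theorem spinalFun_leftInv (m : ℕ) (ω : ℕ → GB →* Equiv.Perm (Fin (m + 2)))
    (b : GB) (n : ℕ) (w : List (Fin (m + 2))) :
    spinalFun m ω b⁻¹ n (spinalFun m ω b n w) = w := by
  induction w generalizing n with
  | nil => simp [spinalFun]
  | cons y w ih =>
    by_cases h1 : y = qtop m
    · simp [spinalFun, h1, ih]
    · by_cases h2 : y = qone m
      · match w with
        | [] => simp [spinalFun, h1, h2]
        | z :: w' => simp [spinalFun, h1, h2, map_inv, qone_ne_qtop]
      · simp [spinalFun, h1, h2]

/-- The tree automorphism induced by `b : G_B` via the sequence `ω`. -/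
def spinalAut (m : ℕ) (ω : ℕ → GB →* Equiv.Perm (Fin (m + 2))) (b : GB) :
    Equiv.Perm (List (Fin (m + 2))) where
  toFun := spinalFun m ω b 0
  invFun := spinalFun m ω b⁻¹ 0
  left_inv w := spinalFun_leftInv m ω b 0 w
  right_inv w := by simpa using spinalFun_leftInv m ω b⁻¹ 0 w

/-- The canonical generating set `S_ω = A ∪ B_ω` (non-identity induced automorphisms). -/
def genSet (m : ℕ) (GA : Subgroup (Equiv.Perm (Fin (m + 2))))
    (ω : ℕ → GB →* Equiv.Perm (Fin (m + 2))) : Set (Equiv.Perm (List (Fin (m + 2)))) :=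
  ((rootAut m '' (GA : Set (Equiv.Perm (Fin (m + 2))))) ∪
    Set.range fun b : GB => spinalAut m ω b) \ {1}

/-- The spinal group `G_ω`, as a subgroup of the permutation group of the vertex set
of the `(m+2)`-regular rooted tree. -/
def spinalGroup (m : ℕ) (GA : Subgroup (Equiv.Perm (Fin (m + 2))))
    (ω : ℕ → GB →* Equiv.Perm (Fin (m + 2))) : Subgroup (Equiv.Perm (List (Fin (m + 2)))) :=
  Subgroup.closure (genSet m GA ω)

/-- The defining conditions on the data `(G_A, G_B, ω)` of a spinal group:
`G_A` is a transitive (hence faithful) group of permutations of the alphabet,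
every `ω n` is an epimorphism onto `G_A`, and `ω ∈ Ω̂`: from every index on, the kernels
of the remaining homomorphisms cover `G_B` and intersect trivially. -/
structure SpinalData (m : ℕ) (GA : Subgroup (Equiv.Perm (Fin (m + 2))))
    (ω : ℕ → GB →* Equiv.Perm (Fin (m + 2))) : Prop where
  transitive : ∀ i j : Fin (m + 2), ∃ a ∈ GA, a i = j
  range_eq : ∀ n, (ω n).range = GA
  kernels_cover : ∀ i : ℕ, ∀ b : GB, ∃ j, i ≤ j ∧ ω j b = 1
  kernels_sep : ∀ i : ℕ, ∀ b : GB, (∀ j, i ≤ j → ω j b = 1) → b = 1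

/-- Word length of a group element with respect to a set of generators. -/
def wordLength {G : Type*} [Group G] (S : Set G) (g : G) : ℕ :=
  sInf {n | ∃ l : List G, l.length = n ∧ (∀ x ∈ l, x ∈ S) ∧ l.prod = g}

/-- The word growth function `γ_ω` of the spinal group with respect to `S_ω`. -/
def growth (m : ℕ) (GA : Subgroup (Equiv.Perm (Fin (m + 2))))
    (ω : ℕ → GB →* Equiv.Perm (Fin (m + 2))) (n : ℕ) : ℕ :=
  Nat.card {g : Equiv.Perm (List (Fin (m + 2))) //
    g ∈ spinalGroup m GA ω ∧ wordLength (genSet m GA ω) g ≤ n}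

/-- The period growth function `π_ω`: the largest order of an element of word length
at most `n`. -/
def periodGrowth (m : ℕ) (GA : Subgroup (Equiv.Perm (Fin (m + 2))))
    (ω : ℕ → GB →* Equiv.Perm (Fin (m + 2))) (n : ℕ) : ℕ :=
  sSup (orderOf '' {g : Equiv.Perm (List (Fin (m + 2))) |
    g ∈ spinalGroup m GA ω ∧ wordLength (genSet m GA ω) g ≤ n})

/-- Abstract letters for words over `S_ω`: an `A`-letter is (induced by) a permutation
of the alphabet, a `B`-letter is (induced by) an element of `G_B`. -/
abbrev Letter (m : ℕ) (GB : Type*) := Equiv.Perm (Fin (m + 2)) ⊕ GB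

/-- Evaluation of an abstract letter as a tree automorphism. -/
def evalLetter (m : ℕ) (ω : ℕ → GB →* Equiv.Perm (Fin (m + 2))) :
    Letter m GB → Equiv.Perm (List (Fin (m + 2))) :=
  Sum.elim (rootAut m) (spinalAut m ω)

/-- The list of `A`-letters of a word, in order. -/
def aLetters {m : ℕ} {GB : Type*} : List (Letter m GB) → List (Equiv.Perm (Fin (m + 2))) :=
  List.filterMap fun x => match x with
    | Sum.inl a => some a
    | Sum.inr _ => none

/-- The list of `B`-letters of a word, in order. -/
def bLetters {m : ℕ} {GB : Type*} : List (Letter m GB) → List GB :=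
  List.filterMap fun x => match x with
    | Sum.inl _ => none
    | Sum.inr b => some b

/-- A word is reduced if its letters alternate between `A`-letters and `B`-letters and
no letter is the identity. -/
def IsReduced {m : ℕ} (F : List (Letter m GB)) : Prop :=
  List.Chain' (fun x y => x.isLeft ≠ y.isLeft) F ∧
    Sum.inl (1 : Equiv.Perm (Fin (m + 2))) ∉ F ∧ Sum.inr (1 : GB) ∉ F

open scoped Classical in
/-- One step of the (complete, confluent) simple reduction process: prepend a letter to an
already reduced word and reduce. -/
def reduceStep {m : ℕ} : Letter m GB → List (Letter m GB) → List (Letter m GB)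
  | Sum.inl a, [] => if a = 1 then [] else [Sum.inl a]
  | Sum.inr b, [] => if b = 1 then [] else [Sum.inr b]
  | Sum.inl a, Sum.inl a' :: t => if a * a' = 1 then t else Sum.inl (a * a') :: t
  | Sum.inr b, Sum.inr b' :: t => if b * b' = 1 then t else Sum.inr (b * b') :: t
  | Sum.inl a, y :: t => if a = 1 then y :: t else Sum.inl a :: y :: t
  | Sum.inr b, y :: t => if b = 1 then y :: t else Sum.inr b :: y :: t

/-- The reduced form of a word, obtained by simple reductions. -/
def reduceWord {m : ℕ} (F : List (Letter m GB)) : List (Letter m GB) :=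
  F.foldr reduceStep []

open scoped Classical in
/-- The (unreduced) projection of a word, representing an element of the first-level
stabilizer, to the coordinate `i` of the first level: scanning the word from the left
while accumulating the product `g` of the `A`-letters, a `B`-letter `b` contributes the
letter `b` at the coordinate `g(q)` and the letter `ω₁(b)` at the coordinate `g(1)`. -/
def projWord (m : ℕ) (ω0 : GB →* Equiv.Perm (Fin (m + 2))) (i : Fin (m + 2)) :
    List (Letter m GB) → Equiv.Perm (Fin (m + 2)) → List (Letter m GB)
  | [], _ => []
  | Sum.inl a :: F, g => projWord m ω0 i F (g * a)
  | Sum.inr b :: F, g =>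
      ((if g (qtop m) = i then [Sum.inr b] else []) ++
        (if g (qone m) = i then [Sum.inl (ω0 b)] else [])) ++ projWord m ω0 i F g

/-- The list of the `q^r` (reduced) words at level `r` of the depth-`r` decomposition
of a word. -/
def levelWords (m : ℕ) :
    (ℕ → GB →* Equiv.Perm (Fin (m + 2))) → ℕ → List (Letter m GB) →
      List (List (Letter m GB))
  | _, 0, F => [F]
  | ω, r + 1, F =>
      (List.finRange (m + 2)).flatMap fun i =>
        levelWords m (fun n => ω (n + 1)) r (reduceWord (projWord m (ω 0) i F 1))

/-- `|L_r(F)|`: the total length of level `r` of the depth-`r` decomposition of `F`. -/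
def levelLength (m : ℕ) (ω : ℕ → GB →* Equiv.Perm (Fin (m + 2))) (r : ℕ)
    (F : List (Letter m GB)) : ℕ :=
  ((levelWords m ω r F).map List.length).sum

/-- The triangular weight of a letter: `A`-letters have weight `τ₀ = 1 - η^r`; a
`B`-letter `b` has weight `τ_i = η^r + η^(r-i) - 1` where `i` is the smallest (1-based)
index with `ω_i(b) = 1`. -/
def letterWeight (m : ℕ) (ω : ℕ → GB →* Equiv.Perm (Fin (m + 2))) (η : ℝ) (r : ℕ) :
    Letter m GB → ℝ
  | Sum.inl _ => 1 - η ^ r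
  | Sum.inr b => η ^ r + η ^ (r - (sInf {j | ω j b = 1} + 1)) - 1

/-- The total triangular weight of a word. -/
def wordWeight (m : ℕ) (ω : ℕ → GB →* Equiv.Perm (Fin (m + 2))) (η : ℝ) (r : ℕ)
    (F : List (Letter m GB)) : ℝ :=
  (F.map (letterWeight m ω η r)).sum

/-- The weight `∂^τ(g)` of a group element: the least total weight of a word over `S_ω`
representing it. -/
def elemWeight (m : ℕ) (GA : Subgroup (Equiv.Perm (Fin (m + 2))))
    (ω : ℕ → GB →* Equiv.Perm (Fin (m + 2))) (η : ℝ) (r : ℕ)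
    (g : Equiv.Perm (List (Fin (m + 2)))) : ℝ :=
  sInf {x : ℝ | ∃ F : List (Letter m GB),
    (∀ a : Equiv.Perm (Fin (m + 2)), Sum.inl a ∈ F → a ∈ GA) ∧
    (F.map (evalLetter m ω)).prod = g ∧ wordWeight m ω η r F = x}

theorem rootAut_mul (m : ℕ) (a a' : Equiv.Perm (Fin (m + 2))) :
    rootAut m (a * a') = rootAut m a * rootAut m a' := by
  ext w : 1
  cases w <;> rfl

theorem spinalFun_mul (m : ℕ) (ω : ℕ → GB →* Equiv.Perm (Fin (m + 2))) (b b' : GB) (n : ℕ)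
    (w : List (Fin (m + 2))) :
    spinalFun m ω (b * b') n w = spinalFun m ω b n (spinalFun m ω b' n w) := by
  induction w generalizing n with
  | nil => simp [spinalFun]
  | cons y w ih =>
    by_cases h1 : y = qtop m
    · simp [spinalFun, h1, ih]
    · by_cases h2 : y = qone m
      · cases w <;> simp [spinalFun, h2, qone_ne_qtop]
      · simp [spinalFun, h1, h2]

theorem spinalAut_mul (m : ℕ) (ω : ℕ → GB →* Equiv.Perm (Fin (m + 2))) (b b' : GB) :
    spinalAut m ω (b * b') = spinalAut m ω b * spinalAut m ω b' := by
  ext w : 1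
  exact spinalFun_mul m ω b b' 0 w

/-- The homomorphism from the root permutations to tree automorphisms. -/
def rootHom (m : ℕ) : Equiv.Perm (Fin (m + 2)) →* Equiv.Perm (List (Fin (m + 2))) :=
  MonoidHom.mk' (rootAut m) (rootAut_mul m)

/-- The homomorphism from the level group to tree automorphisms. -/
def spinalHom (m : ℕ) (ω : ℕ → GB →* Equiv.Perm (Fin (m + 2))) :
    GB →* Equiv.Perm (List (Fin (m + 2))) :=
  MonoidHom.mk' (spinalAut m ω) (spinalAut_mul m ω)

theorem spinalFun_succ (m : ℕ) (ω : ℕ → GB →* Equiv.Perm (Fin (m + 2))) (b : GB) (n : ℕ)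
    (w : List (Fin (m + 2))) :
    spinalFun m ω b (n + 1) w = spinalFun m (fun k => ω (k + 1)) b n w := by
  induction w generalizing n with
  | nil => simp [spinalFun]
  | cons y w ih =>
    by_cases h1 : y = qtop m
    · simp [spinalFun, h1, ih]
    · by_cases h2 : y = qone m
      · cases w <;> simp [spinalFun, h2, qone_ne_qtop]
      · simp [spinalFun, h1, h2]

/-- Evaluation of a word as a tree automorphism. -/
def evalWord (m : ℕ) (ω : ℕ → GB →* Equiv.Perm (Fin (m + 2))) (F : List (Letter m GB)) :
    Equiv.Perm (List (Fin (m + 2))) :=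
  (F.map (evalLetter m ω)).prod

theorem evalWord_append (m : ℕ) (ω : ℕ → GB →* Equiv.Perm (Fin (m + 2)))
    (F F' : List (Letter m GB)) :
    evalWord m ω (F ++ F') = evalWord m ω F * evalWord m ω F' := by
  simp [evalWord]

theorem evalWord_cons (m : ℕ) (ω : ℕ → GB →* Equiv.Perm (Fin (m + 2)))
    (x : Letter m GB) (F : List (Letter m GB)) :
    evalWord m ω (x :: F) = evalLetter m ω x * evalWord m ω F := by
  simp [evalWord]

/-- All `A`-letters of the word come from `GA`. -/
def IsOver {m : ℕ} (GA : Subgroup (Equiv.Perm (Fin (m + 2)))) (F : List (Letter m GB)) : Prop :=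
  ∀ a, Sum.inl a ∈ F → a ∈ GA

/-- The weight of a word whose `A`-letters have weight `1` and whose `B`-letters are weighted
by `β`. -/
def betaWeight {m : ℕ} (β : GB → ℕ) (F : List (Letter m GB)) : ℕ :=
  (F.map (Sum.elim (fun _ => 1) β)).sum

theorem betaWeight_append {m : ℕ} (β : GB → ℕ) (F F' : List (Letter m GB)) :
    betaWeight β (F ++ F') = betaWeight β F + betaWeight β F' := by
  simp [betaWeight]

theorem betaWeight_cons {m : ℕ} (β : GB → ℕ) (x : Letter m GB) (F : List (Letter m GB)) :
    betaWeight β (x :: F) = Sum.elim (fun _ => 1) β x + betaWeight β F := by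
  simp [betaWeight]

/-- A word is balanced if it has as many `A`-letters as `B`-letters. -/
def IsBalanced {m : ℕ} (F : List (Letter m GB)) : Prop :=
  (F.map Sum.isLeft).count true = (F.map Sum.isLeft).count false

/-- Two adjacent letters of the same type can be merged into one without increasing the weight. -/
theorem exists_merge (m : ℕ) (GA : Subgroup (Equiv.Perm (Fin (m + 2))))
    (ω : ℕ → GB →* Equiv.Perm (Fin (m + 2))) (β : GB → ℕ)
    (hβ : ∀ b b', β (b * b') ≤ β b + β b') (x y : Letter m GB) (hxy : x.isLeft = y.isLeft)
    (F₁ F₂ : List (Letter m GB)) (hF : IsOver GA (F₁ ++ x :: y :: F₂)) :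
    ∃ z : Letter m GB, IsOver GA (F₁ ++ z :: F₂) ∧
      evalWord m ω (F₁ ++ z :: F₂) = evalWord m ω (F₁ ++ x :: y :: F₂) ∧
      betaWeight β (F₁ ++ z :: F₂) ≤ betaWeight β (F₁ ++ x :: y :: F₂) := by
  rcases x with a | b <;> rcases y with a' | b' <;> simp at hxy
  · refine ⟨Sum.inl (a * a'), fun c hc => ?_, ?_, ?_⟩
    · simp only [List.mem_append, List.mem_cons, Sum.inl.injEq] at hc
      rcases hc with hc | rfl | hc
      · exact hF c (by simp [hc])
      · exact GA.mul_mem (hF _ (by simp)) (hF _ (by simp))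
      · exact hF c (by simp [hc])
    · simp [evalWord_append, evalWord_cons, evalLetter, rootAut_mul, mul_assoc]
    · simp [betaWeight_append, betaWeight_cons]
  · refine ⟨Sum.inr (b * b'), fun c hc => hF c ?_, ?_, ?_⟩
    · simpa using hc
    · simp [evalWord_append, evalWord_cons, evalLetter, spinalAut_mul, mul_assoc]
    · have := hβ b b'
      simp [betaWeight_append, betaWeight_cons]
      omega

theorem isBalanced_of_isChain {m : ℕ} (F : List (Letter m GB)) (z : Letter m GB)
    (h : ((F ++ [z]).map Sum.isLeft).IsChain (· ≠ ·))
    (h' : (((z :: F) ++ [z]).map Sum.isLeft).IsChain (· ≠ ·)) : IsBalanced (F ++ [z]) := by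
  unfold IsBalanced
  rcases Nat.even_or_odd (F ++ [z]).length with he | ho
  · exact (h.count_false_eq_count_true (by simpa using he)).symm
  · have h1 : Even (((z :: F) ++ [z]).map Sum.isLeft).length := by
      simp at ho ⊢
      grind
    have h2 := h'.count_false_eq_count_true h1
    have hF : (F.map Sum.isLeft).IsChain (· ≠ ·) := by
      rw [List.map_append] at h
      exact h.left_of_append
    have h3 := hF.count_false_eq_count_true (by simp at ho ⊢; grind)
    rcases z with a | b <;> simp at h2 <;> omega

/-- Cyclic reduction: up to conjugation, a word may be replaced by a word of no larger weight
that is either balanced or has at most one letter. -/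
theorem exists_cyclic_reduction (m : ℕ) (GA : Subgroup (Equiv.Perm (Fin (m + 2))))
    (ω : ℕ → GB →* Equiv.Perm (Fin (m + 2))) (β : GB → ℕ)
    (hβ : ∀ b b', β (b * b') ≤ β b + β b') (n : ℕ) :
    ∀ F : List (Letter m GB), F.length = n → IsOver GA F →
    ∃ F' : List (Letter m GB), IsOver GA F' ∧ IsConj (evalWord m ω F) (evalWord m ω F') ∧
      betaWeight β F' ≤ betaWeight β F ∧ (F'.length ≤ 1 ∨ IsBalanced F') := by
  induction n with
  | zero => exact fun F h hF => ⟨F, hF, IsConj.refl _, le_rfl, Or.inl (by omega)⟩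
  | succ n ih =>
    have merge : ∀ F : List (Letter m GB), F.length = n + 1 → IsOver GA F →
        ¬ (F.map Sum.isLeft).IsChain (· ≠ ·) →
        ∃ F' : List (Letter m GB), IsOver GA F' ∧ IsConj (evalWord m ω F) (evalWord m ω F') ∧
          betaWeight β F' ≤ betaWeight β F ∧ (F'.length ≤ 1 ∨ IsBalanced F') := by
      intro F hlen hF hch
      rw [List.isChain_map, List.isChain_iff_forall_rel_of_append_cons_cons] at hch
      push Not at hch
      obtain ⟨x, y, F₁, F₂, rfl, hxy⟩ := hch
      obtain ⟨z, hz, hev, hw⟩ := exists_merge m GA ω β hβ x y hxy F₁ F₂ hF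
      obtain ⟨F', h1, h2, h3, h4⟩ := ih (F₁ ++ z :: F₂) (by
        simp only [List.length_append, List.length_cons] at hlen ⊢
        omega) hz
      exact ⟨F', h1, hev ▸ h2, h3.trans hw, h4⟩
    intro F hlen hF
    obtain ⟨F₀, z, rfl⟩ : ∃ F₀ z, F = F₀ ++ [z] :=
      ⟨F.dropLast, F.getLast (by rintro rfl; simp at hlen),
        (List.dropLast_append_getLast _).symm⟩
    by_cases hch : ((F₀ ++ [z]).map Sum.isLeft).IsChain (· ≠ ·)
    · by_cases hch' : ((z :: F₀).map Sum.isLeft).IsChain (· ≠ ·)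
      · rcases F₀ with _ | ⟨y, F₀⟩
        · exact ⟨_, hF, IsConj.refl _, le_rfl, Or.inl (by simp)⟩
        · refine ⟨_, hF, IsConj.refl _, le_rfl, Or.inr (isBalanced_of_isChain _ z hch ?_)⟩
          simp only [List.cons_append, List.map_cons, List.isChain_cons_cons] at hch hch' ⊢
          exact ⟨hch'.1, hch⟩
      · have hrot : IsConj (evalWord m ω (F₀ ++ [z])) (evalWord m ω (z :: F₀)) := by
          rw [isConj_iff]
          refine ⟨evalWord m ω [z], ?_⟩
          simp [evalWord, mul_assoc]
        obtain ⟨F', h1, h2, h3, h4⟩ := merge (z :: F₀) (by simpa using hlen)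
          (fun a ha => hF a (by simp at ha ⊢; tauto)) hch'
        refine ⟨F', h1, hrot.trans h2, h3.trans (le_of_eq ?_), h4⟩
        simp [betaWeight, add_comm]
    · exact merge _ hlen hF hch

/-- The action of a word on the first level. -/
def rootPerm {m : ℕ} (F : List (Letter m GB)) : Equiv.Perm (Fin (m + 2)) :=
  (F.map (Sum.elim id fun _ => 1)).prod

theorem rootPerm_cons {m : ℕ} (x : Letter m GB) (F : List (Letter m GB)) :
    rootPerm (x :: F) = Sum.elim id (fun _ => 1) x * rootPerm F := by
  simp [rootPerm]

theorem rootPerm_mem {m : ℕ} {GA : Subgroup (Equiv.Perm (Fin (m + 2)))}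
    {F : List (Letter m GB)} (hF : IsOver GA F) : rootPerm F ∈ GA := by
  refine Subgroup.list_prod_mem _ fun x hx => ?_
  obtain ⟨c, hc, rfl⟩ := List.mem_map.1 hx
  rcases c with a | b
  · exact hF a hc
  · exact GA.one_mem

/-- The section of a letter at a first level vertex, as a word. -/
def letterSection {m : ℕ} (ω0 : GB →* Equiv.Perm (Fin (m + 2))) :
    Letter m GB → Fin (m + 2) → List (Letter m GB)
  | Sum.inl _, _ => []
  | Sum.inr b, y =>
    if y = qtop m then [Sum.inr b]
    else if y = qone m then (if ω0 b = 1 then [] else [Sum.inl (ω0 b)]) else []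

/-- The section of a word at a first level vertex. -/
def wordSection {m : ℕ} (ω0 : GB →* Equiv.Perm (Fin (m + 2))) :
    List (Letter m GB) → Fin (m + 2) → List (Letter m GB)
  | [], _ => []
  | x :: F, y => letterSection ω0 x (rootPerm F y) ++ wordSection ω0 F y

/-- The section of the `k`-th power of a word at a first level vertex. -/
def powSection {m : ℕ} (ω0 : GB →* Equiv.Perm (Fin (m + 2))) (F : List (Letter m GB)) :
    ℕ → Fin (m + 2) → List (Letter m GB)
  | 0, _ => []
  | k + 1, y => wordSection ω0 F ((rootPerm F ^ k) y) ++ powSection ω0 F k y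

theorem evalLetter_apply_cons (m : ℕ) (ω : ℕ → GB →* Equiv.Perm (Fin (m + 2)))
    (x : Letter m GB) (y : Fin (m + 2)) (w : List (Fin (m + 2))) :
    evalLetter m ω x (y :: w) = (Sum.elim id (fun _ => 1) x : Equiv.Perm (Fin (m + 2))) y ::
      evalWord m (fun k => ω (k + 1)) (letterSection (ω 0) x y) w := by
  rcases x with a | b
  · rfl
  · change spinalFun m ω b 0 (y :: w) = _
    by_cases h1 : y = qtop m
    · simp only [spinalFun, h1, letterSection, if_true, evalWord]
      rw [spinalFun_succ]
      simp [evalLetter, spinalAut]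
    · by_cases h2 : y = qone m
      · subst h2
        by_cases h3 : ω 0 b = 1
        · cases w <;> simp [spinalFun, qone_ne_qtop, letterSection, h3, evalWord]
        · cases w <;> simp [spinalFun, qone_ne_qtop, letterSection, h3, evalWord, evalLetter,
            rootAut, rootFun]
      · simp [spinalFun, h1, h2, letterSection, evalWord]

theorem evalWord_apply_cons (m : ℕ) (ω : ℕ → GB →* Equiv.Perm (Fin (m + 2)))
    (F : List (Letter m GB)) (y : Fin (m + 2)) (w : List (Fin (m + 2))) :
    evalWord m ω F (y :: w) =
      rootPerm F y :: evalWord m (fun k => ω (k + 1)) (wordSection (ω 0) F y) w := by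
  induction F with
  | nil => rfl
  | cons x F ih =>
    rw [evalWord_cons, Equiv.Perm.mul_apply, ih, evalLetter_apply_cons, wordSection,
      evalWord_append, rootPerm_cons]
    rfl

theorem evalWord_pow_apply_cons (m : ℕ) (ω : ℕ → GB →* Equiv.Perm (Fin (m + 2)))
    (F : List (Letter m GB)) (k : ℕ) (y : Fin (m + 2)) (w : List (Fin (m + 2))) :
    (evalWord m ω F ^ k) (y :: w) =
      (rootPerm F ^ k) y :: evalWord m (fun k => ω (k + 1)) (powSection (ω 0) F k y) w := by
  induction k with
  | zero => rfl
  | succ k ih =>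
    rw [pow_succ', Equiv.Perm.mul_apply, ih, evalWord_apply_cons, powSection,
      evalWord_append, pow_succ']
    rfl

theorem evalLetter_nil (m : ℕ) (ω : ℕ → GB →* Equiv.Perm (Fin (m + 2))) (x : Letter m GB) :
    evalLetter m ω x [] = [] := by
  rcases x with a | b <;> simp [evalLetter, rootAut, rootFun, spinalAut, spinalFun]

theorem evalWord_nil_apply (m : ℕ) (ω : ℕ → GB →* Equiv.Perm (Fin (m + 2)))
    (F : List (Letter m GB)) : evalWord m ω F [] = [] := by
  induction F with
  | nil => rfl
  | cons x F ih => rw [evalWord_cons, Equiv.Perm.mul_apply, ih, evalLetter_nil]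

/-- If a power of the root permutation vanishes, the order of the word is controlled by the orders
of the sections of that power. -/
theorem evalWord_pow_mul_eq_one (m : ℕ) (ω : ℕ → GB →* Equiv.Perm (Fin (m + 2)))
    (F : List (Letter m GB)) (s k : ℕ) (hs : rootPerm F ^ s = 1)
    (hk : ∀ y, evalWord m (fun k => ω (k + 1)) (powSection (ω 0) F s y) ^ k = 1) :
    evalWord m ω F ^ (s * k) = 1 := by
  ext w : 1
  rw [pow_mul]
  rcases w with _ | ⟨y, w⟩
  · have h : Function.IsFixedPt (evalWord m ω F) [] := evalWord_nil_apply m ω F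
    rw [← pow_mul, ← Equiv.Perm.iterate_eq_pow]
    exact h.iterate _
  · have h : ∀ n : ℕ, ((evalWord m ω F ^ s) ^ n) (y :: w) =
        y :: (evalWord m (fun k => ω (k + 1)) (powSection (ω 0) F s y) ^ n) w := by
      intro n
      induction n with
      | zero => rfl
      | succ n ih =>
        rw [pow_succ', Equiv.Perm.mul_apply, ih, evalWord_pow_apply_cons, hs, pow_succ']
        rfl
    rw [h, hk]
    rfl

theorem isOver_append {m : ℕ} {GA : Subgroup (Equiv.Perm (Fin (m + 2)))}
    {F F' : List (Letter m GB)} (h : IsOver GA F) (h' : IsOver GA F') : IsOver GA (F ++ F') :=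
  fun a ha => (List.mem_append.1 ha).elim (h a) (h' a)

theorem isOver_letterSection {m : ℕ} {GA : Subgroup (Equiv.Perm (Fin (m + 2)))}
    {ω0 : GB →* Equiv.Perm (Fin (m + 2))} (h0 : ω0.range = GA) (x : Letter m GB)
    (y : Fin (m + 2)) : IsOver GA (letterSection ω0 x y) := by
  intro a ha
  rcases x with c | b
  · simp [letterSection] at ha
  · rw [← h0]
    simp only [letterSection] at ha
    split_ifs at ha <;> simp at ha
    exact ⟨b, ha.symm⟩

theorem isOver_wordSection {m : ℕ} {GA : Subgroup (Equiv.Perm (Fin (m + 2)))}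
    {ω0 : GB →* Equiv.Perm (Fin (m + 2))} (h0 : ω0.range = GA) (F : List (Letter m GB))
    (y : Fin (m + 2)) : IsOver GA (wordSection ω0 F y) := by
  induction F with
  | nil => intro a ha; simp [wordSection] at ha
  | cons x F ih => exact isOver_append (isOver_letterSection h0 _ _) ih

theorem isOver_powSection {m : ℕ} {GA : Subgroup (Equiv.Perm (Fin (m + 2)))}
    {ω0 : GB →* Equiv.Perm (Fin (m + 2))} (h0 : ω0.range = GA) (F : List (Letter m GB))
    (k : ℕ) (y : Fin (m + 2)) : IsOver GA (powSection ω0 F k y) := by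
  induction k with
  | zero => intro a ha; simp [powSection] at ha
  | succ k ih => exact isOver_append (isOver_wordSection h0 _ _) ih

/-- The total weight of the sections of a letter. -/
theorem sum_betaWeight_letterSection {m : ℕ} (ω0 : GB →* Equiv.Perm (Fin (m + 2)))
    (β' : GB → ℕ) (x : Letter m GB) :
    ∑ y, betaWeight β' (letterSection ω0 x y) =
      Sum.elim (fun _ => 0) (fun b => β' b + if ω0 b = 1 then 0 else 1) x := by
  rcases x with a | b
  · simp [letterSection, betaWeight]
  · have h : ∀ y, betaWeight β' (letterSection ω0 (Sum.inr b : Letter m GB) y) =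
        (if y = qtop m then β' b else 0) +
        (if y = qone m then (if ω0 b = 1 then 0 else 1) else 0) := by
      intro y
      by_cases h1 : y = qtop m
      · simp [letterSection, betaWeight, h1, (qone_ne_qtop m).symm]
      · by_cases h2 : y = qone m <;> by_cases h3 : ω0 b = 1 <;>
          simp [letterSection, betaWeight, h1, h2, h3, qone_ne_qtop]
    simp [h, Finset.sum_add_distrib]

/-- The total weight of the sections of a word. -/
theorem sum_betaWeight_wordSection {m : ℕ} (ω0 : GB →* Equiv.Perm (Fin (m + 2)))
    (β' : GB → ℕ) (F : List (Letter m GB)) :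
    ∑ y, betaWeight β' (wordSection ω0 F y) =
      (F.map (Sum.elim (fun _ => 0) (fun b => β' b + if ω0 b = 1 then 0 else 1))).sum := by
  induction F with
  | nil => simp [wordSection, betaWeight]
  | cons x F ih =>
    simp only [wordSection, betaWeight_append, Finset.sum_add_distrib, ih, List.map_cons,
      List.sum_cons]
    rw [Equiv.sum_comp (rootPerm F) (fun y => betaWeight β' (letterSection ω0 x y)),
      sum_betaWeight_letterSection]

theorem betaWeight_powSection {m : ℕ} (ω0 : GB →* Equiv.Perm (Fin (m + 2)))
    (β' : GB → ℕ) (F : List (Letter m GB)) (k : ℕ) (y : Fin (m + 2)) :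
    betaWeight β' (powSection ω0 F k y) =
      ∑ i ∈ Finset.range k, betaWeight β' (wordSection ω0 F ((rootPerm F ^ i) y)) := by
  induction k with
  | zero => simp [powSection, betaWeight]
  | succ k ih => rw [powSection, betaWeight_append, ih, Finset.sum_range_succ, add_comm]

theorem betaWeight_powSection_le {m : ℕ} (ω0 : GB →* Equiv.Perm (Fin (m + 2)))
    (β' : GB → ℕ) (F : List (Letter m GB)) (y : Fin (m + 2)) (k : ℕ)
    (hk : k ≤ Function.minimalPeriod (rootPerm F) y) :
    betaWeight β' (powSection ω0 F k y) ≤ ∑ z, betaWeight β' (wordSection ω0 F z) := by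
  classical
  rw [betaWeight_powSection]
  have hinj : Set.InjOn (fun i => (rootPerm F ^ i) y) (Finset.range k : Set ℕ) := by
    intro i hi j hj hij
    simp only [Finset.coe_range, Set.mem_Iio] at hi hj
    simp only [← Equiv.Perm.iterate_eq_pow] at hij
    exact (Function.iterate_eq_iterate_iff_of_lt_minimalPeriod (hi.trans_le hk)
      (hj.trans_le hk)).1 hij
  rw [← Finset.sum_image (f := fun z => betaWeight β' (wordSection ω0 F z)) hinj]
  exact Finset.sum_le_univ_sum_of_nonneg fun _ => Nat.zero_le _

/-- In a balanced word each `B`-letter pays for itself and for one `A`-letter. -/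
theorem IsBalanced.betaWeight_eq {m : ℕ} {F : List (Letter m GB)} (hF : IsBalanced F)
    (β : GB → ℕ) :
    betaWeight β F = (F.map (Sum.elim (fun _ => 0) (fun b => β b + 1))).sum := by
  have h : ∀ F : List (Letter m GB), betaWeight β F + (F.map Sum.isLeft).count false =
      (F.map (Sum.elim (fun _ => 0) (fun b => β b + 1))).sum +
        (F.map Sum.isLeft).count true := by
    intro F
    induction F with
    | nil => simp [betaWeight]
    | cons x F ih =>
      rw [betaWeight_cons]
      rcases x with a | b <;> simp <;> omega
  have := h F
  unfold IsBalanced at hF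
  omega

/-- The common cycle length of a regular permutation divides the size of the alphabet. -/
theorem minimalPeriod_dvd_card {α : Type*} [Fintype α] (a : Equiv.Perm α)
    (ha : ∀ y z : α, Function.minimalPeriod (⇑a) y = Function.minimalPeriod (⇑a) z) (y : α) :
    Function.minimalPeriod (⇑a) y ∣ Fintype.card α := by
  classical
  have h := Fintype.card_congr
    (MulAction.selfEquivSigmaOrbits (Subgroup.zpowers a) α)
  rw [h, Fintype.card_sigma]
  refine Finset.dvd_sum fun o _ => ?_
  rw [← MulAction.minimalPeriod_eq_card, ha y o.out]
  exact dvd_rfl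

theorem pow_minimalPeriod_eq_one {α : Type*} (a : Equiv.Perm α)
    (ha : ∀ y z : α, Function.minimalPeriod (⇑a) y = Function.minimalPeriod (⇑a) z) (y : α) :
    a ^ Function.minimalPeriod (⇑a) y = 1 := by
  ext z
  rw [← Equiv.Perm.iterate_eq_pow, ha y z, Function.iterate_minimalPeriod]
  rfl

section Regular

variable {m : ℕ} {GA : Subgroup (Equiv.Perm (Fin (m + 2)))}

theorem pow_card_eq_one_of_regular
    (hreg : ∀ a ∈ GA, ∀ y z : Fin (m + 2),
      Function.minimalPeriod (⇑a) y = Function.minimalPeriod (⇑a) z)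
    {a : Equiv.Perm (Fin (m + 2))} (ha : a ∈ GA) : a ^ (m + 2) = 1 := by
  have h := minimalPeriod_dvd_card a (hreg a ha) 0
  rw [Fintype.card_fin] at h
  obtain ⟨c, hc⟩ := h
  have h1 : a ^ (Function.minimalPeriod a 0 * c) = 1 := by
    rw [pow_mul, pow_minimalPeriod_eq_one a (hreg a ha), one_pow]
  rwa [← hc] at h1

/-- A word with at most one letter has order dividing the size of the alphabet. -/
theorem evalWord_pow_of_length_le_one
    (hreg : ∀ a ∈ GA, ∀ y z : Fin (m + 2),
      Function.minimalPeriod (⇑a) y = Function.minimalPeriod (⇑a) z)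
    (ω : ℕ → GB →* Equiv.Perm (Fin (m + 2))) (hrange : ∀ n, (ω n).range = GA)
    (hsep : ∀ b : GB, (∀ j, ω j b = 1) → b = 1) (F : List (Letter m GB)) (hF : IsOver GA F)
    (hlen : F.length ≤ 1) : evalWord m ω F ^ (m + 2) = 1 := by
  rcases F with _ | ⟨x, _ | ⟨y, F⟩⟩
  · simp [evalWord]
  · rcases x with a | b
    · have h : evalWord m ω [Sum.inl a] = rootHom m a := by simp [evalWord, evalLetter, rootHom]
      rw [h, ← map_pow, pow_card_eq_one_of_regular hreg (hF a (by simp)), map_one]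
    · have h : evalWord m ω [Sum.inr b] = spinalHom m ω b := by
        simp [evalWord, evalLetter, spinalHom]
      rw [h, ← map_pow, hsep (b ^ (m + 2)), map_one]
      intro j
      rw [map_pow]
      exact pow_card_eq_one_of_regular hreg (hrange j ▸ ⟨b, rfl⟩)
  · simp at hlen

theorem IsConj.pow_eq_one_of {G : Type*} [Group G] {g h : G} (hgh : IsConj g h) {n : ℕ}
    (hn : h ^ n = 1) : g ^ n = 1 := by
  obtain ⟨c, rfl⟩ := isConj_iff.1 hgh.symm
  rw [conj_pow, hn]
  simp

/-- All words over `GA` and `GB` of `β`-weight at most `W` have order dividing `q ^ (M + 1)`. -/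
def OrderBound (GA : Subgroup (Equiv.Perm (Fin (m + 2))))
    (ω : ℕ → GB →* Equiv.Perm (Fin (m + 2))) (β : GB → ℕ) (W M : ℕ) : Prop :=
  ∀ F : List (Letter m GB), IsOver GA F → betaWeight β F ≤ W →
    evalWord m ω F ^ ((m + 2) ^ (M + 1)) = 1

theorem OrderBound.mono_exponent {ω : ℕ → GB →* Equiv.Perm (Fin (m + 2))} {β : GB → ℕ}
    {W M M' : ℕ} (h : OrderBound GA ω β W M) (hM : M ≤ M') : OrderBound GA ω β W M' := by
  intro F hF hW
  obtain ⟨c, hc⟩ := pow_dvd_pow (m + 2) (Nat.add_le_add_right hM 1)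
  rw [hc, pow_mul, h F hF hW, one_pow]

/-- It suffices to bound the orders of balanced words. -/
theorem orderBound_of_balanced
    (hreg : ∀ a ∈ GA, ∀ y z : Fin (m + 2),
      Function.minimalPeriod (⇑a) y = Function.minimalPeriod (⇑a) z)
    {ω : ℕ → GB →* Equiv.Perm (Fin (m + 2))} (hrange : ∀ n, (ω n).range = GA)
    (hsep : ∀ b : GB, (∀ j, ω j b = 1) → b = 1) {β : GB → ℕ}
    (hβ : ∀ b b', β (b * b') ≤ β b + β b') {W M : ℕ}
    (h : ∀ F : List (Letter m GB), IsOver GA F → IsBalanced F → betaWeight β F ≤ W →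
      evalWord m ω F ^ ((m + 2) ^ (M + 1)) = 1) : OrderBound GA ω β W M := by
  intro F hF hW
  obtain ⟨F', h1, h2, h3, h4 | h4⟩ := exists_cyclic_reduction m GA ω β hβ _ F rfl hF
  · refine IsConj.pow_eq_one_of h2 ?_
    rw [pow_succ', pow_mul, evalWord_pow_of_length_le_one hreg ω hrange hsep F' h1 h4, one_pow]
  · exact IsConj.pow_eq_one_of h2 (h F' h1 h4 (h3.trans hW))

/-- Passing to the next level costs one factor `q` in the order. -/
theorem OrderBound.of_succ
    (hreg : ∀ a ∈ GA, ∀ y z : Fin (m + 2),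
      Function.minimalPeriod (⇑a) y = Function.minimalPeriod (⇑a) z)
    {ω : ℕ → GB →* Equiv.Perm (Fin (m + 2))} (hrange : ∀ n, (ω n).range = GA)
    (hsep : ∀ b : GB, (∀ j, ω j b = 1) → b = 1) {β β' : GB → ℕ}
    (hβ : ∀ b b', β (b * b') ≤ β b + β b')
    (hββ' : ∀ b, (β' b + if ω 0 b = 1 then 0 else 1) ≤ β b + 1) {W M : ℕ}
    (h : OrderBound GA (fun k => ω (k + 1)) β' W M) : OrderBound GA ω β W (M + 1) := by
  refine orderBound_of_balanced hreg hrange hsep hβ fun F hF hbal hW => ?_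
  have hσ := hreg _ (rootPerm_mem hF)
  set s := Function.minimalPeriod (rootPerm F) 0 with hs
  obtain ⟨c, hc⟩ : s ∣ m + 2 := by
    simpa using minimalPeriod_dvd_card (rootPerm F) hσ 0
  have hpow : evalWord m ω F ^ (s * (m + 2) ^ (M + 1)) = 1 := by
    refine evalWord_pow_mul_eq_one m ω F s _ (pow_minimalPeriod_eq_one _ hσ 0) fun y =>
      h _ (isOver_powSection (hrange 0) F s y) (le_trans ?_ hW)
    refine (betaWeight_powSection_le _ _ _ _ _ (hσ 0 y).le).trans ?_
    rw [sum_betaWeight_wordSection, hbal.betaWeight_eq]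
    refine List.sum_le_sum fun x _ => ?_
    rcases x with a | b
    · exact le_rfl
    · exact hββ' b
  have hdvd : (m + 2) ^ (M + 1 + 1) = s * (m + 2) ^ (M + 1) * c := by
    rw [pow_succ]
    nth_rewrite 2 [hc]
    ring
  rw [hdvd, pow_mul, hpow, one_pow]

end Regular

open scoped Classical in
/-- The weight of a `B`-letter at depth `d` below the start of a block: it doubles once the letter
has been killed by one of the homomorphisms of the block already passed. -/
def blockWeight {m : ℕ} (ω : ℕ → GB →* Equiv.Perm (Fin (m + 2))) (d : ℕ) (b : GB) : ℕ :=
  if ∃ i < d, ω i b = 1 then 2 else 1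

section Block

variable {m : ℕ} {GA : Subgroup (Equiv.Perm (Fin (m + 2)))}

theorem blockWeight_mul_le (ω : ℕ → GB →* Equiv.Perm (Fin (m + 2))) (d : ℕ) (b b' : GB) :
    blockWeight ω d (b * b') ≤ blockWeight ω d b + blockWeight ω d b' := by
  unfold blockWeight
  split_ifs <;> omega

theorem blockWeight_succ_le (ω : ℕ → GB →* Equiv.Perm (Fin (m + 2))) (d : ℕ) (b : GB) :
    (blockWeight ω (d + 1) b + if ω d b = 1 then 0 else 1) ≤ blockWeight ω d b + 1 := by
  have hle : ∀ e, blockWeight ω e b ≤ 2 := fun e => by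
    unfold blockWeight
    split_ifs <;> omega
  have hpos : 1 ≤ blockWeight ω d b := by
    unfold blockWeight
    split_ifs <;> omega
  by_cases h : ω d b = 1
  · have := hle (d + 1)
    simp only [h, if_true]
    omega
  · have : blockWeight ω (d + 1) b = blockWeight ω d b := by
      unfold blockWeight
      simp only [Nat.lt_succ_iff_lt_or_eq, or_and_right, exists_or, exists_eq_left, h, or_false]
    simp [this, h]

/-- Going down `d` levels inside a block. -/
theorem OrderBound.of_depth
    (hreg : ∀ a ∈ GA, ∀ y z : Fin (m + 2),
      Function.minimalPeriod (⇑a) y = Function.minimalPeriod (⇑a) z)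
    {ω : ℕ → GB →* Equiv.Perm (Fin (m + 2))} (hrange : ∀ n, (ω n).range = GA)
    (hsep : ∀ i, ∀ b : GB, (∀ j, i ≤ j → ω j b = 1) → b = 1) {W M : ℕ} (d : ℕ)
    (h : OrderBound GA (fun k => ω (d + k)) (blockWeight ω d) W M) :
    OrderBound GA ω (blockWeight ω 0) W (M + d) := by
  induction d generalizing M with
  | zero => simpa using h
  | succ d ih =>
    have h' : OrderBound GA (fun k => ω (d + k)) (blockWeight ω d) W (M + 1) := by
      refine OrderBound.of_succ (ω := fun k => ω (d + k)) (β' := blockWeight ω (d + 1)) hreg (fun n => hrange _) ?_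
        (blockWeight_mul_le ω d) (fun b => blockWeight_succ_le ω d b) ?_
      · exact fun b hb => hsep d b fun j hj => by simpa [Nat.add_sub_cancel' hj] using hb (j - d)
      · simpa only [Nat.add_assoc, Nat.add_comm 1] using h
    have := ih h'
    rwa [Nat.add_assoc, Nat.add_comm 1] at this

theorem betaWeight_one {F : List (Letter m GB)} : betaWeight (fun _ => 1) F = F.length := by
  induction F with
  | nil => rfl
  | cons x F ih =>
    rw [betaWeight_cons, ih]
    rcases x with a | b <;> simp [add_comm]

/-- Passing through a complete block reduces the length by the factor `2/3`. -/
theorem OrderBound.of_block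
    (hreg : ∀ a ∈ GA, ∀ y z : Fin (m + 2),
      Function.minimalPeriod (⇑a) y = Function.minimalPeriod (⇑a) z)
    {ω : ℕ → GB →* Equiv.Perm (Fin (m + 2))} (hrange : ∀ n, (ω n).range = GA)
    (hsep : ∀ i, ∀ b : GB, (∀ j, i ≤ j → ω j b = 1) → b = 1) {W M : ℕ} (d : ℕ)
    (hcomplete : ∀ b : GB, ∃ i < d, ω i b = 1)
    (h : OrderBound GA (fun k => ω (d + k)) (fun _ => 1) (2 * W / 3) M) :
    OrderBound GA ω (fun _ => 1) W (M + d) := by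
  have h0 : blockWeight ω 0 = fun _ => 1 := by
    funext b
    simp [blockWeight]
  have hd : blockWeight ω d = fun _ => 2 := by
    funext b
    simp [blockWeight, hcomplete b]
  rw [← h0]
  refine OrderBound.of_depth hreg hrange hsep d ?_
  rw [hd]
  refine orderBound_of_balanced hreg (fun n => hrange _) ?_ (by simp) fun F hF hbal hW => ?_
  · exact fun b hb => hsep d b fun j hj => by simpa [Nat.add_sub_cancel' hj] using hb (j - d)
  · refine h F hF ?_
    have e : ∀ (c : ℕ) (F : List (Letter m GB)),
        (F.map (Sum.elim (fun _ => 0) (fun _ : GB => c))).sum =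
          c * (F.map Sum.isLeft).count false := by
      intro c F
      induction F with
      | nil => simp
      | cons x F ih =>
        rcases x with a | b <;> simp [ih, mul_add]
        omega
    rw [hbal.betaWeight_eq, e] at hW ⊢
    omega

/-- Iterating over blocks: words of length at most `(4/3) ^ k` have order dividing
`q ^ (k * r + 1)`. -/
theorem orderBound_of_factorable
    (hreg : ∀ a ∈ GA, ∀ y z : Fin (m + 2),
      Function.minimalPeriod (⇑a) y = Function.minimalPeriod (⇑a) z)
    {ω : ℕ → GB →* Equiv.Perm (Fin (m + 2))} (hdata : SpinalData m GA ω) {r : ℕ}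
    {t : ℕ → ℕ} (ht : ∀ i, t (i + 1) ≤ t i + r)
    (hcomplete : ∀ i : ℕ, ∀ b : GB, ∃ j, t i ≤ j ∧ j < t (i + 1) ∧ ω j b = 1)
    (k : ℕ) : ∀ (i W : ℕ), W * 3 ^ k ≤ 4 ^ k →
      OrderBound GA (fun n => ω (t i + n)) (fun _ => 1) W (k * r) := by
  have hsep : ∀ c i, ∀ b : GB, (∀ j, i ≤ j → ω (c + j) b = 1) → b = 1 := fun c i b hb =>
    hdata.kernels_sep (c + i) b fun j hj => by
      simpa [Nat.add_sub_cancel' (show c ≤ j by omega)] using hb (j - c) (by omega)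
  induction k with
  | zero =>
    intro i W hW F hF hlen
    rw [betaWeight_one] at hlen
    simpa using evalWord_pow_of_length_le_one hreg _ (fun n => hdata.range_eq _)
      (fun b hb => hsep (t i) 0 b fun j _ => hb j) F hF (by simp at hW; omega)
  | succ k ih =>
    intro i W hW
    have hlt : t i < t (i + 1) := by
      obtain ⟨j, h1, h2, _⟩ := hcomplete i 1
      omega
    have hd : t i + (t (i + 1) - t i) = t (i + 1) := by omega
    refine OrderBound.mono_exponent (M := k * r + (t (i + 1) - t i)) ?_ ?_
    · refine OrderBound.of_block hreg (fun n => hdata.range_eq _) (hsep (t i)) _ ?_ ?_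
      · intro b
        obtain ⟨j, h1, h2, h3⟩ := hcomplete i b
        exact ⟨j - t i, by omega, by rwa [Nat.add_sub_cancel' h1]⟩
      · simp only [← Nat.add_assoc, hd]
        refine ih (i + 1) _ ?_
        have h1 : 2 * W / 3 * 3 ≤ 2 * W := Nat.div_mul_le_self _ _
        rw [pow_succ, pow_succ] at hW
        nlinarith [Nat.zero_le (3 ^ k)]
    · have := ht i
      rw [Nat.succ_mul]
      omega

end Block

/-- Every element of word length at most `n` is represented by a word of length at most `n`. -/
theorem exists_word_of_wordLength_le (m : ℕ) (GA : Subgroup (Equiv.Perm (Fin (m + 2))))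
    (ω : ℕ → GB →* Equiv.Perm (Fin (m + 2))) {g : Equiv.Perm (List (Fin (m + 2)))}
    (hg : g ∈ spinalGroup m GA ω) {n : ℕ} (hn : wordLength (genSet m GA ω) g ≤ n) :
    ∃ F : List (Letter m GB), IsOver GA F ∧ F.length ≤ n ∧ evalWord m ω F = g := by
  have hinv : (genSet m GA ω)⁻¹ ⊆ genSet m GA ω := by
    rintro x ⟨hx | ⟨b, hb⟩, hx1⟩
    · obtain ⟨a, ha, hax⟩ := hx
      refine ⟨Or.inl ⟨a⁻¹, GA.inv_mem ha, ?_⟩, by simpa using hx1⟩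
      have : rootHom m a⁻¹ = x := by rw [map_inv, inv_eq_iff_eq_inv]; exact hax
      exact this
    · refine ⟨Or.inr ⟨b⁻¹, ?_⟩, by simpa using hx1⟩
      have : spinalHom m ω b⁻¹ = x := by rw [map_inv, inv_eq_iff_eq_inv]; exact hb
      exact this
  have hne : {k | ∃ l : List (Equiv.Perm (List (Fin (m + 2)))), l.length = k ∧
      (∀ x ∈ l, x ∈ genSet m GA ω) ∧ l.prod = g}.Nonempty := by
    rw [spinalGroup, ← Subgroup.mem_toSubmonoid, Subgroup.closure_toSubmonoid,
      Set.union_eq_self_of_subset_right hinv] at hg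
    obtain ⟨l, hl, hp⟩ := Submonoid.exists_list_of_mem_closure hg
    exact ⟨_, l, rfl, hl, hp⟩
  obtain ⟨l, hl, hmem, hprod⟩ := Nat.sInf_mem hne
  have hword : ∀ l : List (Equiv.Perm (List (Fin (m + 2)))), (∀ x ∈ l, x ∈ genSet m GA ω) →
      ∃ F : List (Letter m GB), IsOver GA F ∧ F.length = l.length ∧ evalWord m ω F = l.prod := by
    intro l hl
    induction l with
    | nil => exact ⟨[], fun a ha => by simp at ha, rfl, rfl⟩
    | cons x l ih =>
      obtain ⟨F, h1, h2, h3⟩ := ih fun y hy => hl y (by simp [hy])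
      obtain ⟨⟨a, ha, rfl⟩ | ⟨b, rfl⟩, -⟩ := hl x (by simp)
      · refine ⟨Sum.inl a :: F, fun c hc => ?_, by simp [h2], ?_⟩
        · rcases List.mem_cons.1 hc with hc | hc
          · exact Sum.inl.inj hc ▸ ha
          · exact h1 c hc
        · rw [evalWord_cons, h3, List.prod_cons]; rfl
      · refine ⟨Sum.inr b :: F, fun c hc => h1 c (by simpa using hc), by simp [h2], ?_⟩
        rw [evalWord_cons, h3, List.prod_cons]; rfl
  obtain ⟨F, h1, h2, h3⟩ := hword l hmem
  exact ⟨F, h1, by rw [h2, hl]; exact hn, h3.trans hprod⟩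

/-- Period 3/4-Estimate: if the action of `G_A` is regular and `ω ∈ Ω̂` is `r`-factorable,
then `π_ω(n) ≾ n^{r·log_{4/3}(q)}`. -/
theorem spinalGroup_period_growth_factorable (m : ℕ)
    (GA : Subgroup (Equiv.Perm (Fin (m + 2))))
    {GB : Type*} [Group GB] [Finite GB] (ω : ℕ → GB →* Equiv.Perm (Fin (m + 2)))
    (hdata : SpinalData m GA ω)
    (hreg : ∀ a ∈ GA, ∀ y z : Fin (m + 2),
      Function.minimalPeriod (⇑a) y = Function.minimalPeriod (⇑a) z)
    (r : ℕ)
    (hfact : ∃ t : ℕ → ℕ, t 0 = 0 ∧ StrictMono t ∧ (∀ i, t (i + 1) ≤ t i + r) ∧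
      ∀ i : ℕ, ∀ b : GB, ∃ j, t i ≤ j ∧ j < t (i + 1) ∧ ω j b = 1) :
    ∃ C : ℝ, 0 < C ∧ ∀ n : ℕ, 1 ≤ n →
      (periodGrowth m GA ω n : ℝ) ≤ (C * n) ^ ((r : ℝ) * Real.logb (4 / 3) (m + 2)) := by
  obtain ⟨t, ht0, htm, htr, hcomplete⟩ := hfact
  have hr : 1 ≤ r := by
    have := htm (Nat.lt_succ_self 0)
    have := htr 0
    simp at *
    omega
  refine ⟨(4 / 3) ^ 2, by norm_num, fun n hn => ?_⟩
  have hnR : (1 : ℝ) ≤ n := by exact_mod_cast hn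
  set L := Real.logb (4 / 3) n with hL
  have hL0 : 0 ≤ L := Real.logb_nonneg (by norm_num) hnR
  set k := ⌈L⌉₊ with hk
  have hnk : n * 3 ^ k ≤ 4 ^ k := by
    have h1 : (n : ℝ) ≤ (4 / 3) ^ k := by
      rw [← Real.rpow_natCast, ← Real.logb_le_iff_le_rpow (by norm_num) (by linarith)]
      exact Nat.le_ceil L
    rw [div_pow, le_div_iff₀ (by positivity)] at h1
    exact_mod_cast h1
  have hbound : periodGrowth m GA ω n ≤ (m + 2) ^ (k * r + 1) := by
    refine csSup_le' ?_
    rintro _ ⟨g, ⟨hg, hlen⟩, rfl⟩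
    obtain ⟨F, hF, hFn, rfl⟩ := exists_word_of_wordLength_le m GA ω hg hlen
    refine orderOf_le_of_pow_eq_one (by positivity) ?_
    have := orderBound_of_factorable hreg hdata htr hcomplete k 0 n hnk F hF
      (by rwa [betaWeight_one])
    simpa [ht0] using this
  have hq : (1 : ℝ) < (m : ℝ) + 2 := by
    have : (0 : ℝ) ≤ m := Nat.cast_nonneg m
    linarith
  have hexp : (k : ℝ) * r + 1 ≤ (L + 2) * r := by
    have h1 : (k : ℝ) < L + 1 := Nat.ceil_lt_add_one hL0
    have h2 : (1 : ℝ) ≤ r := by exact_mod_cast hr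
    nlinarith
  calc (periodGrowth m GA ω n : ℝ) ≤ ((m : ℝ) + 2) ^ (k * r + 1) := by exact_mod_cast hbound
    _ = ((m : ℝ) + 2) ^ ((k : ℝ) * r + 1) := by
      rw [← Real.rpow_natCast]
      push_cast
      rfl
    _ ≤ ((m : ℝ) + 2) ^ ((L + 2) * r) := Real.rpow_le_rpow_of_exponent_le hq.le hexp
    _ = ((4 / 3) ^ 2 * n) ^ ((r : ℝ) * Real.logb (4 / 3) (m + 2)) := by
      have h1 : ((4 / 3 : ℝ) ^ 2 * n) = (4 / 3) ^ (L + 2) := by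
        rw [Real.rpow_add (by norm_num), hL,
          Real.rpow_logb (by norm_num) (by norm_num) (by linarith), mul_comm]
        norm_num
      nth_rewrite 1 [← Real.rpow_logb (b := 4 / 3) (x := (m : ℝ) + 2) (by norm_num) (by norm_num)
        (by linarith)]
      rw [h1, ← Real.rpow_mul (by norm_num), ← Real.rpow_mul (by norm_num)]
      ring_nf
end Spinal
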